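/- Derivative bound for the Cayley–Menger determinant: fix n ≥ 1, points p₀,…,pₙ ∈ ℝⁿ, and distinct indices i, j ∈ {0,…,n}. Let F : ℝ → ℝ be the function sending t to the determinant of the matrix obtained from the Cayley–Menger matrix D̂ by replacing the two entries d_{ij}² and d_{ji}² with t². Then |F'(d_{ij})| ≤ 4·(r_n + r_{n+1})·(2/n)^{2n−1}·p(T)^{2n−1}, where d_{ij} = |p_i − p_j| and r_k denotes the number of derangements of k elements. -/

import Mathlib

open scoped BigOperators

/-- `n×n` matrix whose columns are `p₁ - p₀, …, pₙ - p₀`. -/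
noncomputable def simMat {n : ℕ} (p : Fin (n + 1) → EuclideanSpace ℝ (Fin n)) :
    Matrix (Fin n) (Fin n) ℝ :=
  Matrix.of fun i j => (p j.succ - p 0) i

/-- Half-perimeter: half the sum of all pairwise distances. -/
noncomputable def hperim {n : ℕ} (p : Fin (n + 1) → EuclideanSpace ℝ (Fin n)) : ℝ :=
  (1 / 2) * ∑ ij ∈ Finset.univ.filter
      (fun ij : Fin (n + 1) × Fin (n + 1) => ij.1 < ij.2), dist (p ij.1) (p ij.2)

/-- Volume of the simplex on `p₀,…,pₙ`. -/
noncomputable def svol {n : ℕ} (p : Fin (n + 1) → EuclideanSpace ℝ (Fin n)) : ℝ :=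
  |(simMat p).det| / (Nat.factorial n : ℝ)

/-- Strength `σ(T) = vol(T)² / p(T)^{2n-1}` (equal to `0` when `p(T) = 0`). -/
noncomputable def strength {n : ℕ} (p : Fin (n + 1) → EuclideanSpace ℝ (Fin n)) : ℝ :=
  (svol p) ^ 2 / (hperim p) ^ (2 * n - 1)

/-- Orientation sign of the simplex, in `{-1, 0, 1}`. -/
noncomputable def ssign {n : ℕ} (p : Fin (n + 1) → EuclideanSpace ℝ (Fin n)) : ℝ :=
  Real.sign (simMat p).det

/-- Signed strength `s(T) = sign(T)·σ(T)`. -/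
noncomputable def signedStrength {n : ℕ} (p : Fin (n + 1) → EuclideanSpace ℝ (Fin n)) : ℝ :=
  ssign p * strength p

/-- The `(n+2)×(n+2)` Cayley–Menger matrix of `p₀,…,pₙ` in which the two entries
`d_{ij}²` and `d_{ji}²` (for fixed distinct `i, j`) are replaced by `t²`:
top row `(0,1,…,1)`, left column `(0,1,…,1)ᵀ`, remaining block `|p_a - p_b|²`
except at the positions `(i,j)` and `(j,i)` where the entry is `t²`. -/
noncomputable def cayleyMengerMod {n : ℕ} (p : Fin (n + 1) → EuclideanSpace ℝ (Fin n))
    (i j : Fin (n + 1)) (t : ℝ) : Matrix (Fin (n + 2)) (Fin (n + 2)) ℝ :=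
  Matrix.of fun a b =>
    Fin.cases (Fin.cases 0 (fun _ => 1) b)
      (fun a' => Fin.cases 1 (fun b' =>
        if (a' = i ∧ b' = j) ∨ (a' = j ∧ b' = i) then t ^ 2
        else dist (p a') (p b') ^ 2) b) a

/-- the sum over ordered pairs is four times the half-perimeter -/
lemma hperim_aux {n : ℕ} (p : Fin (n + 1) → EuclideanSpace ℝ (Fin n)) :
    ∑ a, ∑ b, dist (p a) (p b) = 4 * hperim p := by
  unfold hperim
  rw [Finset.sum_filter, Fintype.sum_prod_type]
  have h1 : ∀ a b : Fin (n + 1), dist (p a) (p b) =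
      (if a < b then dist (p a) (p b) else 0) + (if b < a then dist (p b) (p a) else 0) := by
    intro a b
    rcases lt_trichotomy a b with h | h | h
    · simp [h, h.not_gt]
    · simp [h]
    · simp [h, h.not_gt, dist_comm]
  have h2 : ∑ a, ∑ b, dist (p a) (p b) =
      ∑ a, ∑ b, ((if a < b then dist (p a) (p b) else 0) +
        (if b < a then dist (p b) (p a) else 0)) :=
    Finset.sum_congr rfl fun a _ => Finset.sum_congr rfl fun b _ => h1 a b
  rw [h2]
  simp only [Finset.sum_add_distrib]
  rw [Finset.sum_comm (f := fun a b => if b < a then dist (p b) (p a) else 0)]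
  ring

lemma hperim_nonneg {n : ℕ} (p : Fin (n + 1) → EuclideanSpace ℝ (Fin n)) : 0 ≤ hperim p := by
  unfold hperim
  positivity

/-- every edge is at most `2 p(T) / n` -/
lemma dist_le_hperim {n : ℕ} (hn : 1 ≤ n) (p : Fin (n + 1) → EuclideanSpace ℝ (Fin n))
    (i j : Fin (n + 1)) : dist (p i) (p j) ≤ 2 / (n : ℝ) * hperim p := by
  have hn' : (0 : ℝ) < n := by exact_mod_cast hn
  by_cases hij : i = j
  · subst hij
    have := hperim_nonneg p
    rw [dist_self]; positivity
  have key : 2 * (n : ℝ) * dist (p i) (p j) ≤ 4 * hperim p := by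
    rw [← hperim_aux]
    have hj : j ∈ Finset.univ.erase i := by simp [Ne.symm hij]
    rw [← Finset.add_sum_erase _ _ (Finset.mem_univ i), ← Finset.add_sum_erase _ _ hj, ← add_assoc,
      ← Finset.sum_add_distrib]
    have e1 : ((n : ℝ) + 1) * dist (p i) (p j) ≤
        ∑ b, (dist (p i) (p b) + dist (p j) (p b)) := by
      have : ∑ _b : Fin (n + 1), dist (p i) (p j) ≤
          ∑ b, (dist (p i) (p b) + dist (p j) (p b)) :=
        Finset.sum_le_sum fun b _ => by
          rw [dist_comm (p j) (p b)]; exact dist_triangle _ _ _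
      simpa using this
    have e2 : ((n : ℝ) - 1) * dist (p i) (p j) ≤
        ∑ a ∈ (Finset.univ.erase i).erase j, ∑ b, dist (p a) (p b) := by
      have : ∑ _a ∈ (Finset.univ.erase i).erase j, dist (p i) (p j) ≤
          ∑ a ∈ (Finset.univ.erase i).erase j, ∑ b, dist (p a) (p b) := by
        refine Finset.sum_le_sum fun a _ => ?_
        rw [← Finset.add_sum_erase _ _ (Finset.mem_univ i), ← Finset.add_sum_erase _ _ hj,
          ← add_assoc]
        have h0 : 0 ≤ ∑ b ∈ (Finset.univ.erase i).erase j, dist (p a) (p b) :=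
          Finset.sum_nonneg fun _ _ => dist_nonneg
        have := dist_triangle_left (p i) (p j) (p a)
        linarith
      rw [Finset.sum_const, Finset.card_erase_of_mem hj,
        Finset.card_erase_of_mem (Finset.mem_univ i)] at this
      simpa [Nat.cast_sub hn] using this
    linarith
  rw [div_mul_eq_mul_div, le_div_iff₀ hn']
  linarith

/-- derangements sending `i` to `j` -/
def derTo {m : ℕ} (i j : Fin m) : Finset (Equiv.Perm (Fin m)) :=
  Finset.univ.filter fun σ => (∀ x, σ x ≠ x) ∧ σ i = j

lemma card_derTo_eq {m : ℕ} (i j k : Fin m) (hj : j ≠ i) (hk : k ≠ i) :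
    (derTo i j).card = (derTo i k).card := by
  refine Finset.card_equiv (MulAut.conj (Equiv.swap j k)).toEquiv fun σ => ?_
  simp only [derTo, Finset.mem_filter, Finset.mem_univ, true_and, MulEquiv.toEquiv_eq_coe,
    EquivLike.coe_coe, MulAut.conj_apply, Equiv.swap_inv, Equiv.Perm.mul_apply,
    Equiv.swap_apply_of_ne_of_ne hj.symm hk.symm]
  constructor
  · rintro ⟨h1, h2⟩
    refine ⟨fun x hx => h1 (Equiv.swap j k x) ?_, by rw [h2]; simp⟩
    have := congrArg (Equiv.swap j k) hx
    simpa using this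
  · rintro ⟨h1, h2⟩
    refine ⟨fun x hx => h1 (Equiv.swap j k x) (by simp [hx]), ?_⟩
    have := congrArg (Equiv.swap j k) h2
    simpa using this

lemma card_derTo {n : ℕ} (i j : Fin (n + 2)) (hj : j ≠ i) :
    (derTo i j).card = numDerangements n + numDerangements (n + 1) := by
  have h1 : (Finset.univ.filter fun σ : Equiv.Perm (Fin (n + 2)) => ∀ x, σ x ≠ x).card
      = numDerangements (n + 2) := by
    rw [← card_derangements_fin_eq_numDerangements, Fintype.card_subtype]
    congr 1
    ext σ
    simp only [Finset.mem_filter, Finset.mem_univ, true_and]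
    exact Iff.rfl
  have h2 : (Finset.univ.filter fun σ : Equiv.Perm (Fin (n + 2)) => ∀ x, σ x ≠ x).card
      = ∑ k ∈ Finset.univ.erase i, (derTo i k).card := by
    rw [Finset.card_eq_sum_card_fiberwise (f := fun σ => σ i) (t := Finset.univ.erase i)]
    · simp only [Finset.filter_filter, derTo]
    · intro σ hσ
      simp at hσ ⊢
      exact hσ i
  rw [Finset.sum_congr rfl (fun k hk => card_derTo_eq i k j (by simpa using hk) hj), h1] at h2
  simp [numDerangements_add_two] at h2
  exact h2.symm

/-- derivative of the modified entries, divided by `2 t` -/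
def entryInd {n : ℕ} (i j : Fin (n + 1)) (a b : Fin (n + 2)) : ℝ :=
  if (a = i.succ ∧ b = j.succ) ∨ (a = j.succ ∧ b = i.succ) then 1 else 0

lemma entry_hasDerivAt {n : ℕ} (p : Fin (n + 1) → EuclideanSpace ℝ (Fin n))
    (i j : Fin (n + 1)) (a b : Fin (n + 2)) (t : ℝ) :
    HasDerivAt (fun t => cayleyMengerMod p i j t a b) (2 * t * entryInd i j a b) t := by
  unfold cayleyMengerMod entryInd
  refine Fin.cases ?_ (fun a' => ?_) a
  · refine Fin.cases ?_ (fun b' => ?_) b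
    · simpa [(Fin.succ_ne_zero _).symm] using hasDerivAt_const t (0 : ℝ)
    · simpa [(Fin.succ_ne_zero _).symm] using hasDerivAt_const t (1 : ℝ)
  · refine Fin.cases ?_ (fun b' => ?_) b
    · simpa [(Fin.succ_ne_zero _).symm] using hasDerivAt_const t (1 : ℝ)
    · simp only [Matrix.of_apply, Fin.cases_succ, Fin.succ_inj]
      split_ifs
      · simpa using hasDerivAt_pow 2 t
      · simpa using hasDerivAt_const t (dist (p a') (p b') ^ 2)

/-- entry bounds -/
lemma entry_diag {n : ℕ} (p : Fin (n + 1) → EuclideanSpace ℝ (Fin n))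
    (i j : Fin (n + 1)) (hij : i ≠ j) (a : Fin (n + 2)) (t : ℝ) :
    cayleyMengerMod p i j t a a = 0 := by
  unfold cayleyMengerMod
  refine Fin.cases ?_ (fun a' => ?_) a
  · simp
  · simp only [Matrix.of_apply, Fin.cases_succ]
    rw [if_neg]
    · simp
    · rintro (⟨h1, h2⟩ | ⟨h1, h2⟩)
      · exact hij (h1.symm.trans h2)
      · exact hij (h2.symm.trans h1)

lemma entry_bound {n : ℕ} (hn : 1 ≤ n) (p : Fin (n + 1) → EuclideanSpace ℝ (Fin n))
    (i j : Fin (n + 1)) (a b : Fin (n + 2)) :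
    |cayleyMengerMod p i j (dist (p i) (p j)) a b| ≤
      if b = 0 ∨ a = 0 then 1 else (2 / (n : ℝ) * hperim p) ^ 2 := by
  unfold cayleyMengerMod
  refine Fin.cases ?_ (fun a' => ?_) a
  · refine Fin.cases ?_ (fun b' => ?_) b <;> simp
  · refine Fin.cases ?_ (fun b' => ?_) b
    · simp
    · simp only [Matrix.of_apply, Fin.cases_succ, Fin.succ_ne_zero, or_self, if_false]
      split_ifs <;> rw [abs_of_nonneg (by positivity)] <;>
        exact pow_le_pow_left₀ dist_nonneg (dist_le_hperim hn p _ _) 2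

lemma prod_bound {n : ℕ} (hn : 1 ≤ n) (p : Fin (n + 1) → EuclideanSpace ℝ (Fin n))
    (i j : Fin (n + 1)) (σ : Equiv.Perm (Fin (n + 2))) (hσ : ∀ x, σ x ≠ x) (a : Fin (n + 2))
    (ha : a ≠ 0) (hsa : σ a ≠ 0) :
    |∏ b ∈ Finset.univ.erase a, cayleyMengerMod p i j (dist (p i) (p j)) (σ b) b| ≤
      (2 / (n : ℝ) * hperim p) ^ (2 * (n - 1)) := by
  rw [Finset.abs_prod]
  refine (Finset.prod_le_prod (fun _ _ => abs_nonneg _)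
    (fun b _ => entry_bound hn p i j (σ b) b)).trans (le_of_eq ?_)
  rw [Finset.prod_ite, Finset.prod_const_one, one_mul, Finset.prod_const, ← pow_mul]
  congr 2
  have : (Finset.univ.erase a).filter (fun b => ¬ (b = 0 ∨ σ b = 0)) =
      ((Finset.univ.erase a).erase 0).erase (σ.symm 0) := by
    ext b
    simp only [Finset.mem_filter, Finset.mem_erase, Finset.mem_univ, and_true, not_or]
    rw [ne_eq b (σ.symm 0), Equiv.eq_symm_apply]
    tauto
  have h0 : σ.symm 0 ≠ 0 := by
    intro h
    exact hσ 0 ((Equiv.symm_apply_eq σ).1 h).symm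
  have h1 : σ.symm 0 ≠ a := by
    intro h
    exact hsa ((Equiv.symm_apply_eq σ).1 h).symm
  rw [this, Finset.card_erase_of_mem (by simp [h0, h1]),
    Finset.card_erase_of_mem (by simp [ha.symm]), Finset.card_erase_of_mem (by simp)]
  simp

/-- one summand of the derivative -/
lemma term_bound {n : ℕ} (hn : 1 ≤ n) (p : Fin (n + 1) → EuclideanSpace ℝ (Fin n))
    (i j : Fin (n + 1)) (hij : i ≠ j) (σ : Equiv.Perm (Fin (n + 2))) (a : Fin (n + 2)) :
    |(∏ b ∈ Finset.univ.erase a, cayleyMengerMod p i j (dist (p i) (p j)) (σ b) b) *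
        (2 * dist (p i) (p j) * entryInd i j (σ a) a)| ≤
      (2 * (2 / (n : ℝ) * hperim p) ^ (2 * n - 1)) *
        ((if a = j.succ ∧ σ ∈ derTo j.succ i.succ then 1 else 0) +
         (if a = i.succ ∧ σ ∈ derTo i.succ j.succ then 1 else 0)) := by
  have hL : 0 ≤ 2 / (n : ℝ) * hperim p := by
    have := hperim_nonneg p
    positivity
  by_cases hc : (σ a = i.succ ∧ a = j.succ) ∨ (σ a = j.succ ∧ a = i.succ)
  swap
  · rw [entryInd, if_neg hc]
    simp only [mul_zero, abs_zero]
    positivity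
  by_cases hσ : ∀ x, σ x ≠ x
  swap
  · push Not at hσ
    obtain ⟨x, hx⟩ := hσ
    have hxa : x ≠ a := by
      rintro rfl
      rcases hc with ⟨h1, h2⟩ | ⟨h1, h2⟩
      · exact hij (Fin.succ_injective _ (h1.symm.trans (hx.trans h2)))
      · exact hij (Fin.succ_injective _ (h1.symm.trans (hx.trans h2))).symm
    rw [Finset.prod_eq_zero (Finset.mem_erase.2 ⟨hxa, Finset.mem_univ x⟩)
      (by rw [hx]; exact entry_diag p i j hij x _)]
    simp only [zero_mul, abs_zero]
    positivity
  have ha : a ≠ 0 := by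
    rcases hc with ⟨h1, h2⟩ | ⟨h1, h2⟩ <;> rw [h2] <;> exact Fin.succ_ne_zero _
  have hsa : σ a ≠ 0 := by
    rcases hc with ⟨h1, h2⟩ | ⟨h1, h2⟩ <;> rw [h1] <;> exact Fin.succ_ne_zero _
  have hone : (1 : ℝ) ≤ (if a = j.succ ∧ σ ∈ derTo j.succ i.succ then 1 else 0) +
         (if a = i.succ ∧ σ ∈ derTo i.succ j.succ then 1 else 0) := by
    rcases hc with ⟨h1, h2⟩ | ⟨h1, h2⟩
    · rw [if_pos ⟨h2, by simp only [derTo, Finset.mem_filter, Finset.mem_univ, true_and]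
                         exact ⟨hσ, h2 ▸ h1⟩⟩]
      split_ifs <;> norm_num
    · rw [if_pos (c := a = i.succ ∧ _)
        ⟨h2, by simp only [derTo, Finset.mem_filter, Finset.mem_univ, true_and]
                exact ⟨hσ, h2 ▸ h1⟩⟩]
      split_ifs <;> norm_num
  refine le_trans ?_ (le_mul_of_one_le_right (by positivity) hone)
  rw [entryInd, if_pos hc, mul_one, abs_mul, abs_of_nonneg (a := 2 * dist (p i) (p j))
    (by positivity)]
  have hexp : 2 * n - 1 = 2 * (n - 1) + 1 := by omega
  rw [hexp, pow_succ]
  calc _ ≤ (2 / (n : ℝ) * hperim p) ^ (2 * (n - 1)) * (2 * (2 / (n : ℝ) * hperim p)) :=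
        mul_le_mul (prod_bound hn p i j σ hσ a ha hsa)
          (by linarith [dist_le_hperim hn p i j]) (by positivity) (by positivity)
    _ = _ := by ring

/-- derivative bound for the Cayley–Menger determinant as a function of the
distance `d_{ij}`:
`|F'(d_{ij})| ≤ 4·(rₙ + r_{n+1})·(2/n)^{2n-1}·p(T)^{2n-1}`. -/
theorem cayleyMenger_deriv_bound (n : ℕ) (hn : 1 ≤ n)
    (p : Fin (n + 1) → EuclideanSpace ℝ (Fin n)) (i j : Fin (n + 1)) (hij : i ≠ j) :
    |deriv (fun t : ℝ => (cayleyMengerMod p i j t).det) (dist (p i) (p j))| ≤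
      4 * ((numDerangements n : ℝ) + (numDerangements (n + 1) : ℝ)) *
        (2 / (n : ℝ)) ^ (2 * n - 1) * (hperim p) ^ (2 * n - 1) := by
  have hd : HasDerivAt (fun t : ℝ => (cayleyMengerMod p i j t).det)
      (∑ σ : Equiv.Perm (Fin (n + 2)), ((Equiv.Perm.sign σ : ℤ) : ℝ) *
        ∑ a, (∏ b ∈ Finset.univ.erase a, cayleyMengerMod p i j (dist (p i) (p j)) (σ b) b) *
        (2 * dist (p i) (p j) * entryInd i j (σ a) a)) (dist (p i) (p j)) := by
    simp only [Matrix.det_apply']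
    refine HasDerivAt.fun_sum fun σ _ => HasDerivAt.const_mul _ ?_
    have := HasDerivAt.fun_finsetProd (u := Finset.univ)
      (f := fun b t => cayleyMengerMod p i j t (σ b) b)
      (fun b _ => entry_hasDerivAt p i j (σ b) b (dist (p i) (p j)))
    simpa only [smul_eq_mul] using this
  rw [hd.deriv]
  have hs : ∀ σ : Equiv.Perm (Fin (n + 2)), |((Equiv.Perm.sign σ : ℤ) : ℝ)| = 1 := by
    intro σ
    rcases Int.units_eq_one_or (Equiv.Perm.sign σ) with h | h <;> simp [h]
  have hcount : ∀ k l : Fin (n + 1), k ≠ l →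
      ∑ σ : Equiv.Perm (Fin (n + 2)), ∑ a : Fin (n + 2),
        (if a = k.succ ∧ σ ∈ derTo k.succ l.succ then (1 : ℝ) else 0) =
        (numDerangements n : ℝ) + (numDerangements (n + 1) : ℝ) := by
    intro k l hkl
    have h := card_derTo k.succ l.succ (fun h => hkl (Fin.succ_injective _ h).symm)
    rw [← Nat.cast_add, ← h]
    simp only [ite_and, Finset.sum_ite_eq', Finset.mem_univ, if_true]
    simp
  calc _ ≤ ∑ σ : Equiv.Perm (Fin (n + 2)), ∑ a : Fin (n + 2),
        (2 * (2 / (n : ℝ) * hperim p) ^ (2 * n - 1)) *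
        ((if a = j.succ ∧ σ ∈ derTo j.succ i.succ then 1 else 0) +
         (if a = i.succ ∧ σ ∈ derTo i.succ j.succ then 1 else 0)) := by
        refine (Finset.abs_sum_le_sum_abs _ _).trans (Finset.sum_le_sum fun σ _ => ?_)
        rw [abs_mul, hs, one_mul]
        exact (Finset.abs_sum_le_sum_abs _ _).trans
          (Finset.sum_le_sum fun a _ => term_bound hn p i j hij σ a)
    _ = _ := by
        simp only [← Finset.mul_sum, Finset.sum_add_distrib]
        rw [hcount j i hij.symm, hcount i j hij, mul_pow]
        ring
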